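/- Let α < 0 and let ν be a true m^α-invariant measure of the subcritical BGW process (not killed at 0). Then the series G(z) = ∑_{n≥0} ν(n)·zⁿ converges for every z ∈ [0,1), and there exists a locally finite Borel measure Λ on (0,∞) satisfying Λ(A) = Λ(mA) for every Borel set A ⊆ (0,∞) such that G(z) = ∫₀^∞ e^{(H(z)−1)x}·x^{−α} Λ(dx) for every z ∈ (0,1). -/

import Mathlib

open MeasureTheory Real Set

/-- `convPow q i j` is the `i`-fold convolution power of the offspring distribution `q`
evaluated at `j`, i.e. the transition matrix `P₀(i,j)` of the BGW process. -/
noncomputable def convPow (q : ℕ → ℝ) : ℕ → ℕ → ℝ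
  | 0, j => if j = 0 then 1 else 0
  | i + 1, j => ∑ k ∈ Finset.range (j + 1), convPow q i (j - k) * q k

/-- `ν` is a `lam`-invariant measure on `ℕ* = {1,2,…}` of the BGW process killed at 0. -/
def IsInvMeasure (q : ℕ → ℝ) (lam : ℝ) (ν : ℕ → ℝ) : Prop :=
  (∀ n, 0 ≤ ν n) ∧ ν 0 = 0 ∧
  ∀ j : ℕ, 1 ≤ j →
    Summable (fun i => ν i * convPow q i j) ∧
    ∑' i, ν i * convPow q i j = lam * ν j

/-- `ν` is a true `lam`-invariant measure on `ℕ` of the (non-killed) BGW process. -/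
def IsTrueInvMeasure (q : ℕ → ℝ) (lam : ℝ) (ν : ℕ → ℝ) : Prop :=
  (∀ n, 0 ≤ ν n) ∧
  ∀ j : ℕ,
    Summable (fun i => ν i * convPow q i j) ∧
    ∑' i, ν i * convPow q i j = lam * ν j

/-- `Λ` is a locally finite Borel measure on `(0,∞)` (viewed as a measure on `ℝ` giving
no mass to `(-∞,0]` and finite mass to compact subsets of `(0,∞)`). -/
def IsLocFiniteOnPos (Λ : Measure ℝ) : Prop :=
  Λ (Set.Iic 0) = 0 ∧ ∀ K : Set ℝ, IsCompact K → K ⊆ Set.Ioi 0 → Λ K < ⊤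

/-- `Λ(A) = Λ(mA)` for every Borel set `A ⊆ (0,∞)`. -/
def ScaleInvariant (m : ℝ) (Λ : Measure ℝ) : Prop :=
  ∀ A : Set ℝ, MeasurableSet A → A ⊆ Set.Ioi 0 →
    Λ A = Λ ((fun x => m * x) '' A)


open Filter Topology
open scoped ENNReal NNReal

/-- generating function -/
noncomputable def gf (a : ℕ → ℝ) (z : ℝ) : ℝ := ∑' n, a n * z ^ n

/-- extended generating function -/
noncomputable def egf (a : ℕ → ℝ) (z : ℝ) : ℝ≥0∞ := ∑' n, ENNReal.ofReal (a n * z ^ n)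

theorem gf_summable {a : ℕ → ℝ} (ha : ∀ n, 0 ≤ a n) (hs : Summable a) {z : ℝ}
    (hz0 : 0 ≤ z) (hz1 : z ≤ 1) : Summable fun n => a n * z ^ n :=
  Summable.of_nonneg_of_le (fun n => mul_nonneg (ha n) (pow_nonneg hz0 n))
    (fun n => mul_le_of_le_one_right (ha n) (pow_le_one₀ hz0 hz1)) hs

theorem gf_nonneg {a : ℕ → ℝ} (ha : ∀ n, 0 ≤ a n) {z : ℝ} (hz0 : 0 ≤ z) : 0 ≤ gf a z :=
  tsum_nonneg fun n => mul_nonneg (ha n) (pow_nonneg hz0 n)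

theorem egf_eq {a : ℕ → ℝ} (ha : ∀ n, 0 ≤ a n) (hs : Summable a) {z : ℝ}
    (hz0 : 0 ≤ z) (hz1 : z ≤ 1) : egf a z = ENNReal.ofReal (gf a z) :=
  (ENNReal.ofReal_tsum_of_nonneg (fun n => mul_nonneg (ha n) (pow_nonneg hz0 n))
    (gf_summable ha hs hz0 hz1)).symm

theorem egf_mono {a : ℕ → ℝ} (ha : ∀ n, 0 ≤ a n) {z w : ℝ}
    (hz0 : 0 ≤ z) (hzw : z ≤ w) : egf a z ≤ egf a w :=
  ENNReal.tsum_le_tsum fun n => ENNReal.ofReal_le_ofReal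
    (mul_le_mul_of_nonneg_left (pow_le_pow_left₀ hz0 hzw n) (ha n))

theorem gf_mono {a : ℕ → ℝ} (ha : ∀ n, 0 ≤ a n) (hs : Summable a) {z w : ℝ}
    (hz0 : 0 ≤ z) (hzw : z ≤ w) (hw : w ≤ 1) : gf a z ≤ gf a w :=
  (gf_summable ha hs hz0 (hzw.trans hw)).tsum_le_tsum
    (fun n => (mul_le_mul_of_nonneg_left (pow_le_pow_left₀ hz0 hzw n) (ha n)))
    (gf_summable ha hs (hz0.trans hzw) hw)

theorem gf_one {a : ℕ → ℝ} (h1 : HasSum a 1) : gf a 1 = 1 := by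
  simp [gf, h1.tsum_eq]

theorem gf_zero (a : ℕ → ℝ) : gf a 0 = a 0 := by
  unfold gf
  rw [tsum_eq_single 0]
  · simp
  · intro n hn; simp [hn]

theorem egf_zero (a : ℕ → ℝ) : egf a 0 = ENNReal.ofReal (a 0) := by
  unfold egf
  rw [tsum_eq_single 0]
  · simp
  · intro n hn; simp [hn]

theorem gf_le_one {a : ℕ → ℝ} (ha : ∀ n, 0 ≤ a n) (h1 : HasSum a 1) {z : ℝ}
    (hz0 : 0 ≤ z) (hz1 : z ≤ 1) : gf a z ≤ 1 := by
  have := gf_mono ha h1.summable hz0 hz1 le_rfl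
  rwa [gf_one h1] at this

theorem convPow_nonneg {q : ℕ → ℝ} (hq0 : ∀ k, 0 ≤ q k) (i j : ℕ) : 0 ≤ convPow q i j := by
  induction i generalizing j with
  | zero => unfold convPow; split_ifs <;> norm_num
  | succ i ih =>
    unfold convPow
    exact Finset.sum_nonneg fun k _ => mul_nonneg (ih _) (hq0 k)

theorem convPow_hasSum {q : ℕ → ℝ} (hq0 : ∀ k, 0 ≤ q k) (hs : Summable q) {z : ℝ}
    (hz0 : 0 ≤ z) (hz1 : z ≤ 1) (i : ℕ) :
    HasSum (fun j => convPow q i j * z ^ j) (gf q z ^ i) := by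
  induction i with
  | zero =>
    have : (fun j => convPow q 0 j * z ^ j) = fun j => if j = 0 then 1 else 0 := by
      funext j
      by_cases hj : j = 0 <;> simp [convPow, hj]
    rw [this]
    simpa using hasSum_ite_eq (0 : ℕ) (1 : ℝ)
  | succ i ih =>
    have h1 := ih.summable.norm
    have h2 := (gf_summable hq0 hs hz0 hz1).norm
    have h3 := hasSum_sum_range_mul_of_summable_norm h2 h1
    rw [ih.tsum_eq] at h3
    rw [pow_succ, mul_comm]
    refine Eq.mp (congrArg (fun f => HasSum f _) (funext fun j => ?_)) h3
    symm
    simp only [convPow]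
    rw [Finset.sum_mul]
    apply Finset.sum_congr rfl
    intro k hk
    have hk' : k ≤ j := by simpa [Nat.lt_succ_iff] using hk
    have : z ^ j = z ^ k * z ^ (j - k) := by rw [← pow_add]; congr 1; omega
    rw [this]; ring

theorem egf_comp {q : ℕ → ℝ} (hq0 : ∀ k, 0 ≤ q k) (hs : Summable q) {z : ℝ}
    (hz0 : 0 ≤ z) (hz1 : z ≤ 1) {ν : ℕ → ℝ} (hν : ∀ n, 0 ≤ ν n) :
    egf ν (gf q z) = ∑' j, (∑' i, ENNReal.ofReal (ν i * convPow q i j)) * ENNReal.ofReal (z ^ j) := by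
  unfold egf
  simp_rw [← ENNReal.tsum_mul_right]
  rw [ENNReal.tsum_comm]
  congr 1
  funext i
  have h := convPow_hasSum hq0 hs hz0 hz1 i
  rw [ENNReal.ofReal_mul (hν i), ← h.tsum_eq, ENNReal.ofReal_tsum_of_nonneg
    (fun j => mul_nonneg (convPow_nonneg hq0 i j) (pow_nonneg hz0 j)) h.summable,
    ← ENNReal.tsum_mul_left]
  congr 1
  funext j
  rw [← ENNReal.ofReal_mul (hν i), ← ENNReal.ofReal_mul
    (mul_nonneg (hν i) (convPow_nonneg hq0 i j)), mul_assoc]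

theorem egf_true_inv {q : ℕ → ℝ} (hq0 : ∀ k, 0 ≤ q k) (hs : Summable q) {z : ℝ}
    (hz0 : 0 ≤ z) (hz1 : z ≤ 1) {ν : ℕ → ℝ} {lam : ℝ} (hl : 0 ≤ lam)
    (hν : IsTrueInvMeasure q lam ν) :
    egf ν (gf q z) = ENNReal.ofReal lam * egf ν z := by
  rw [egf_comp hq0 hs hz0 hz1 hν.1]
  unfold egf
  rw [← ENNReal.tsum_mul_left]
  congr 1
  funext j
  rw [← ENNReal.ofReal_tsum_of_nonneg
    (fun i => mul_nonneg (hν.1 i) (convPow_nonneg hq0 i j)) (hν.2 j).1, (hν.2 j).2,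
    ENNReal.ofReal_mul hl, ENNReal.ofReal_mul (hν.1 j), mul_assoc]

theorem gf_min_inv {q : ℕ → ℝ} (hq0 : ∀ k, 0 ≤ q k) (hq1 : HasSum q 1)
    {m : ℝ} (hm0 : 0 ≤ m) {νmin : ℕ → ℝ} (hmin : IsInvMeasure q m νmin)
    (hmin1 : HasSum νmin 1) {z : ℝ} (hz0 : 0 ≤ z) (hz1 : z ≤ 1) :
    1 - gf νmin (gf q z) = m * (1 - gf νmin z) := by
  have hs := hq1.summable
  set A : ℝ≥0∞ := ∑' i, ENNReal.ofReal (νmin i * convPow q i 0) with hA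
  have key : ∀ w : ℝ, 0 ≤ w → w ≤ 1 →
      gf νmin (gf q w) = A.toReal + m * gf νmin w := by
    intro w hw0 hw1
    have h := egf_comp hq0 hs hw0 hw1 hmin.1
    rw [tsum_eq_zero_add' ENNReal.summable, pow_zero, ENNReal.ofReal_one, mul_one, ← hA] at h
    have h2 : ∑' j, (∑' i, ENNReal.ofReal (νmin i * convPow q i (j+1))) *
        ENNReal.ofReal (w ^ (j+1)) = ENNReal.ofReal (m * gf νmin w) := by
      rw [ENNReal.ofReal_mul hm0, ← egf_eq hmin.1 hmin1.summable hw0 hw1]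
      unfold egf
      rw [tsum_eq_zero_add' (f := fun n => ENNReal.ofReal (νmin n * w ^ n)) ENNReal.summable,
        hmin.2.1, zero_mul, ENNReal.ofReal_zero, zero_add, ← ENNReal.tsum_mul_left]
      congr 1
      funext j
      have h3 := hmin.2.2 (j+1) (by omega)
      rw [← ENNReal.ofReal_tsum_of_nonneg
        (fun i => mul_nonneg (hmin.1 i) (convPow_nonneg hq0 i (j+1))) h3.1, h3.2,
        ENNReal.ofReal_mul hm0, ENNReal.ofReal_mul (hmin.1 (j+1)), mul_assoc]
    have hF0 := gf_nonneg hq0 hw0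
    have hF1 := gf_le_one hq0 hq1 hw0 hw1
    rw [h2, egf_eq hmin.1 hmin1.summable hF0 hF1] at h
    have hAne : A ≠ ⊤ := by
      intro hh
      rw [hh, top_add] at h
      exact ENNReal.ofReal_ne_top h
    have h4 := congrArg ENNReal.toReal h
    rwa [ENNReal.toReal_add hAne ENNReal.ofReal_ne_top,
      ENNReal.toReal_ofReal (gf_nonneg hmin.1 hF0),
      ENNReal.toReal_ofReal (mul_nonneg hm0 (gf_nonneg hmin.1 hw0))] at h4
  have k1 := key 1 zero_le_one le_rfl
  rw [gf_one hq1, gf_one hmin1] at k1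
  have k2 := key z hz0 hz1
  linarith

theorem gf_bernoulli {q : ℕ → ℝ} (hq0 : ∀ k, 0 ≤ q k) (hq1 : HasSum q 1)
    {m : ℝ} (hm : HasSum (fun k : ℕ => (k : ℝ) * q k) m) {z : ℝ} (hz0 : 0 ≤ z) (hz1 : z ≤ 1) :
    1 - gf q z ≤ m * (1 - z) := by
  have h1 := hq1.sub (gf_summable hq0 hq1.summable hz0 hz1).hasSum
  have h2 := hm.mul_right (1 - z)
  refine hasSum_le (fun k => ?_) h1 h2
  have hb := one_add_mul_le_pow (a := z - 1) (by linarith) k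
  have : (1 + (z - 1)) = z := by ring
  rw [this] at hb
  nlinarith [hq0 k]

theorem gf_ratio {a : ℕ → ℝ} (ha : ∀ k, 0 ≤ a k) (h1 : HasSum a 1) {z w : ℝ} (hz0 : 0 ≤ z)
    (hzw : z ≤ w) (hw1 : w ≤ 1) :
    (1 - gf a z) * (1 - w) ≤ (1 - gf a w) * (1 - z) := by
  have e1 := (h1.sub (gf_summable ha h1.summable hz0 (hzw.trans hw1)).hasSum).mul_right (1 - w)
  have e2 := (h1.sub (gf_summable ha h1.summable (hz0.trans hzw) hw1).hasSum).mul_right (1 - z)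
  refine hasSum_le (fun k => ?_) e1 e2
  have g1 := mul_neg_geom_sum z k
  have g2 := mul_neg_geom_sum w k
  have g3 : ∑ i ∈ Finset.range k, z ^ i ≤ ∑ i ∈ Finset.range k, w ^ i :=
    Finset.sum_le_sum fun i _ => pow_le_pow_left₀ hz0 hzw i
  have : (a k - a k * z ^ k) * (1 - w) = a k * ((1 - z) * (1 - w)) * ∑ i ∈ Finset.range k, z ^ i := by
    linear_combination -(a k * (1 - w)) * g1
  rw [this]
  have : (a k - a k * w ^ k) * (1 - z) = a k * ((1 - z) * (1 - w)) * ∑ i ∈ Finset.range k, w ^ i := by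
    linear_combination -(a k * (1 - z)) * g2
  rw [this]
  apply mul_le_mul_of_nonneg_left g3
  exact mul_nonneg (ha k) (mul_nonneg (by linarith) (by linarith))

theorem gf_deriv {q : ℕ → ℝ} (hq0 : ∀ k, 0 ≤ q k) (hq1 : HasSum q 1)
    {m : ℝ} (hm : HasSum (fun k : ℕ => (k : ℝ) * q k) m) {x : ℕ → ℝ}
    (hx0 : ∀ n, 0 ≤ x n) (hx1 : ∀ n, x n < 1) (hx : Tendsto x atTop (𝓝 1)) :
    Tendsto (fun n => (1 - gf q (x n)) / (1 - x n)) atTop (𝓝 m) := by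
  have h : ∀ n, (1 - gf q (x n)) / (1 - x n) = ∑' k, q k * ∑ i ∈ Finset.range k, x n ^ i := by
    intro n
    have e1 := (hq1.sub (gf_summable hq0 hq1.summable (hx0 n) (hx1 n).le).hasSum).div_const (1 - x n)
    change HasSum _ ((1 - gf q (x n)) / (1 - x n)) at e1
    rw [← e1.tsum_eq]
    congr 1
    funext k
    have g1 := mul_neg_geom_sum (x n) k
    have : 1 - x n ≠ 0 := by linarith [hx1 n]
    rw [div_eq_iff this]
    linear_combination -(q k) * g1
  simp_rw [h]
  rw [← hm.tsum_eq]
  refine tendsto_tsum_of_dominated_convergence hm.summable (fun k => ?_)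
    (Eventually.of_forall fun n k => ?_)
  · have : (k : ℝ) * q k = q k * ∑ i ∈ Finset.range k, (1:ℝ) ^ i := by simp [mul_comm]
    rw [this]
    exact (tendsto_finsetSum _ fun i _ => hx.pow i).const_mul _
  · rw [Real.norm_of_nonneg (mul_nonneg (hq0 k) (Finset.sum_nonneg fun i _ => pow_nonneg (hx0 n) i)),
      mul_comm]
    apply mul_le_mul_of_nonneg_right _ (hq0 k)
    calc _ ≤ ∑ i ∈ Finset.range k, (1:ℝ) :=
          Finset.sum_le_sum fun i _ => pow_le_one₀ (hx0 n) (hx1 n).le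
      _ = k := by simp

theorem gf_cont {a : ℕ → ℝ} (ha : ∀ n, 0 ≤ a n) (hs : Summable a) :
    ContinuousOn (gf a) (Icc 0 1) := by
  refine continuousOn_tsum (u := a) (fun n => by fun_prop) hs (fun n z hz => ?_)
  rw [Real.norm_of_nonneg (mul_nonneg (ha n) (pow_nonneg hz.1 n))]
  exact mul_le_of_le_one_right (ha n) (pow_le_one₀ hz.1 hz.2)

section dyn

variable {q : ℕ → ℝ} {m : ℝ} {νmin : ℕ → ℝ}

theorem gf_le_self (hmin : IsInvMeasure q m νmin) (hmin1 : HasSum νmin 1) {z : ℝ}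
    (hz0 : 0 ≤ z) (hz1 : z ≤ 1) : gf νmin z ≤ z := by
  have h1 := (gf_summable hmin.1 hmin1.summable hz0 hz1).hasSum
  have h2 := hmin1.mul_right z
  rw [one_mul] at h2
  refine hasSum_le (fun k => ?_) h1 h2
  rcases Nat.eq_zero_or_pos k with hk | hk
  · subst hk; simp [hmin.2.1]
  · exact mul_le_mul_of_nonneg_left (pow_le_of_le_one hz0 hz1 hk.ne') (hmin.1 k)

theorem F_lt_one (hq0 : ∀ k, 0 ≤ q k) (hq1 : HasSum q 1) (hm0 : 0 < m)
    (hmin : IsInvMeasure q m νmin) (hmin1 : HasSum νmin 1) {z : ℝ}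
    (hz0 : 0 ≤ z) (hz1 : z < 1) : gf q z < 1 := by
  refine lt_of_le_of_ne (gf_le_one hq0 hq1 hz0 hz1.le) fun h => ?_
  have h1 := gf_min_inv hq0 hq1 hm0.le hmin hmin1 hz0 hz1.le
  rw [h, gf_one hmin1] at h1
  have h2 := gf_le_self hmin hmin1 hz0 hz1.le
  have : 0 < m * (1 - gf νmin z) := mul_pos hm0 (by linarith)
  linarith

theorem F_pos (hq0 : ∀ k, 0 ≤ q k) (hq1 : HasSum q 1)
    (hm : HasSum (fun k : ℕ => (k : ℝ) * q k) m) (hm0 : 0 < m) (hm1 : m < 1) {z : ℝ}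
    (hz0 : 0 ≤ z) (hz1 : z ≤ 1) : 0 < gf q z := by
  have := gf_bernoulli hq0 hq1 hm hz0 hz1
  nlinarith

theorem iter_mem (hq0 : ∀ k, 0 ≤ q k) (hq1 : HasSum q 1) (hm0 : 0 < m)
    (hmin : IsInvMeasure q m νmin) (hmin1 : HasSum νmin 1) {z : ℝ}
    (hz0 : 0 ≤ z) (hz1 : z < 1) (n : ℕ) : 0 ≤ (gf q)^[n] z ∧ (gf q)^[n] z < 1 := by
  induction n with
  | zero => exact ⟨hz0, hz1⟩
  | succ n ih =>
    rw [Function.iterate_succ_apply']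
    exact ⟨gf_nonneg hq0 ih.1, F_lt_one hq0 hq1 hm0 hmin hmin1 ih.1 ih.2⟩

theorem iter_pos (hq0 : ∀ k, 0 ≤ q k) (hq1 : HasSum q 1)
    (hm : HasSum (fun k : ℕ => (k : ℝ) * q k) m) (hm0 : 0 < m) (hm1 : m < 1)
    (hmin : IsInvMeasure q m νmin) (hmin1 : HasSum νmin 1) {z : ℝ}
    (hz0 : 0 < z) (hz1 : z < 1) (n : ℕ) : 0 < (gf q)^[n] z := by
  cases n with
  | zero => exact hz0
  | succ n =>
    rw [Function.iterate_succ_apply']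
    have h := iter_mem hq0 hq1 hm0 hmin hmin1 hz0.le hz1 n
    exact F_pos hq0 hq1 hm hm0 hm1 h.1 h.2.le

theorem iter_mono (hq0 : ∀ k, 0 ≤ q k) (hq1 : HasSum q 1) (hm0 : 0 < m)
    (hmin : IsInvMeasure q m νmin) (hmin1 : HasSum νmin 1) {z w : ℝ}
    (hz0 : 0 ≤ z) (hzw : z ≤ w) (hw1 : w < 1) (n : ℕ) : (gf q)^[n] z ≤ (gf q)^[n] w := by
  induction n with
  | zero => exact hzw
  | succ n ih =>
    rw [Function.iterate_succ_apply', Function.iterate_succ_apply']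
    exact gf_mono hq0 hq1.summable (iter_mem hq0 hq1 hm0 hmin hmin1 hz0 (hzw.trans_lt hw1) n).1 ih
      (iter_mem hq0 hq1 hm0 hmin hmin1 (hz0.trans hzw) hw1 n).2.le

theorem iter_tendsto (hq0 : ∀ k, 0 ≤ q k) (hq1 : HasSum q 1)
    (hm : HasSum (fun k : ℕ => (k : ℝ) * q k) m) (hm0 : 0 < m) (hm1 : m < 1)
    (hmin : IsInvMeasure q m νmin) (hmin1 : HasSum νmin 1) {z : ℝ}
    (hz0 : 0 ≤ z) (hz1 : z < 1) : Tendsto (fun n => (gf q)^[n] z) atTop (𝓝 1) := by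
  have hb : ∀ n, 1 - (gf q)^[n] z ≤ m ^ n := by
    intro n
    induction n with
    | zero => simpa using hz0
    | succ n ih =>
      have h := iter_mem hq0 hq1 hm0 hmin hmin1 hz0 hz1 n
      rw [Function.iterate_succ_apply', pow_succ']
      exact (gf_bernoulli hq0 hq1 hm h.1 h.2.le).trans (mul_le_mul_of_nonneg_left ih hm0.le)
  have h1 : Tendsto (fun n : ℕ => 1 - m ^ n) atTop (𝓝 1) := by
    simpa using (tendsto_pow_atTop_nhds_zero_of_lt_one hm0.le hm1).const_sub 1
  refine tendsto_of_tendsto_of_tendsto_of_le_of_le h1 tendsto_const_nhds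
    (fun n => by have := hb n; simp only; linarith)
    (fun n => (iter_mem hq0 hq1 hm0 hmin hmin1 hz0 hz1 n).2.le)

theorem iter_H (hq0 : ∀ k, 0 ≤ q k) (hq1 : HasSum q 1) (hm0 : 0 < m)
    (hmin : IsInvMeasure q m νmin) (hmin1 : HasSum νmin 1) {z : ℝ}
    (hz0 : 0 ≤ z) (hz1 : z < 1) (n : ℕ) :
    1 - gf νmin ((gf q)^[n] z) = m ^ n * (1 - gf νmin z) := by
  induction n with
  | zero => simp
  | succ n ih =>
    have h := iter_mem hq0 hq1 hm0 hmin hmin1 hz0 hz1 n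
    rw [Function.iterate_succ_apply', gf_min_inv hq0 hq1 hm0.le hmin hmin1 h.1 h.2.le, ih]
    ring

theorem iter_egf (hq0 : ∀ k, 0 ≤ q k) (hq1 : HasSum q 1) (hm0 : 0 < m)
    (hmin : IsInvMeasure q m νmin) (hmin1 : HasSum νmin 1) {ν : ℕ → ℝ} {lam : ℝ} (hl : 0 ≤ lam)
    (hν : IsTrueInvMeasure q lam ν) {z : ℝ}
    (hz0 : 0 ≤ z) (hz1 : z < 1) (n : ℕ) :
    egf ν ((gf q)^[n] z) = ENNReal.ofReal lam ^ n * egf ν z := by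
  induction n with
  | zero => simp
  | succ n ih =>
    have h := iter_mem hq0 hq1 hm0 hmin hmin1 hz0 hz1 n
    rw [Function.iterate_succ_apply', egf_true_inv hq0 hq1.summable h.1 h.2.le hl hν, ih]
    ring

theorem egf_ne_top (hq0 : ∀ k, 0 ≤ q k) (hq1 : HasSum q 1)
    (hm : HasSum (fun k : ℕ => (k : ℝ) * q k) m) (hm0 : 0 < m) (hm1 : m < 1)
    (hmin : IsInvMeasure q m νmin) (hmin1 : HasSum νmin 1) {ν : ℕ → ℝ} {lam : ℝ} (hl : 0 ≤ lam)
    (hν : IsTrueInvMeasure q lam ν) {z : ℝ}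
    (hz0 : 0 ≤ z) (hz1 : z < 1) : egf ν z ≠ ⊤ := by
  have h := iter_tendsto hq0 hq1 hm hm0 hm1 hmin hmin1 le_rfl zero_lt_one
  obtain ⟨n, hn⟩ := (h.eventually (lt_mem_nhds hz1)).exists
  have h1 := egf_mono hν.1 hz0 hn.le
  rw [iter_egf hq0 hq1 hm0 hmin hmin1 hl hν le_rfl zero_lt_one n, egf_zero] at h1
  exact ne_top_of_le_ne_top (ENNReal.mul_ne_top (ENNReal.pow_ne_top ENNReal.ofReal_ne_top)
    ENNReal.ofReal_ne_top) h1

/-- `c n = 1 - F_n(0)` -/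
noncomputable def cc (q : ℕ → ℝ) (n : ℕ) : ℝ := 1 - (gf q)^[n] 0

theorem cc_pos (hq0 : ∀ k, 0 ≤ q k) (hq1 : HasSum q 1) (hm0 : 0 < m)
    (hmin : IsInvMeasure q m νmin) (hmin1 : HasSum νmin 1) (n : ℕ) : 0 < cc q n := by
  have := (iter_mem hq0 hq1 hm0 hmin hmin1 le_rfl zero_lt_one n).2
  unfold cc; linarith

theorem cc_ratio (hq0 : ∀ k, 0 ≤ q k) (hq1 : HasSum q 1)
    (hm : HasSum (fun k : ℕ => (k : ℝ) * q k) m) (hm0 : 0 < m) (hm1 : m < 1)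
    (hmin : IsInvMeasure q m νmin) (hmin1 : HasSum νmin 1) (k : ℕ) :
    Tendsto (fun n => cc q (n + k) / cc q n) atTop (𝓝 (m ^ k)) := by
  induction k with
  | zero =>
    have : (fun n => cc q (n + 0) / cc q n) = fun _ => 1 := by
      funext n; exact div_self (cc_pos hq0 hq1 hm0 hmin hmin1 n).ne'
    rw [this, pow_zero]; exact tendsto_const_nhds
  | succ k ih =>
    have hd := gf_deriv hq0 hq1 hm (x := fun n => (gf q)^[n] 0)
      (fun n => (iter_mem hq0 hq1 hm0 hmin hmin1 le_rfl zero_lt_one n).1)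
      (fun n => (iter_mem hq0 hq1 hm0 hmin hmin1 le_rfl zero_lt_one n).2)
      (iter_tendsto hq0 hq1 hm hm0 hm1 hmin hmin1 le_rfl zero_lt_one)
    have hd' := (tendsto_add_atTop_iff_nat k).2 hd
    have := hd'.mul ih
    rw [pow_succ']
    refine this.congr fun n => ?_
    have e : 1 - gf q ((gf q)^[n + k] 0) = cc q (n + (k + 1)) := by
      rw [← Function.iterate_succ_apply' (gf q)]; rfl
    rw [e]
    change cc q (n + (k+1)) / cc q (n + k) * (cc q (n + k) / cc q n) = _
    exact div_mul_div_cancel₀ (cc_pos hq0 hq1 hm0 hmin hmin1 (n + k)).ne'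

theorem yaglom (hq0 : ∀ k, 0 ≤ q k) (hq1 : HasSum q 1)
    (hm : HasSum (fun k : ℕ => (k : ℝ) * q k) m) (hm0 : 0 < m) (hm1 : m < 1)
    (hmin : IsInvMeasure q m νmin) (hmin1 : HasSum νmin 1) {z : ℝ}
    (hz0 : 0 ≤ z) (hz1 : z < 1) :
    Tendsto (fun n => (1 - (gf q)^[n] z) / cc q n) atTop (𝓝 (1 - gf νmin z)) := by
  have hH : 0 < 1 - gf νmin z := by linarith [gf_le_self hmin hmin1 hz0 hz1.le]
  have hH0 : gf νmin 0 = 0 := by rw [gf_zero, hmin.2.1]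
  obtain ⟨k, hk⟩ := ((iter_tendsto hq0 hq1 hm hm0 hm1 hmin hmin1 le_rfl zero_lt_one).eventually
    (lt_mem_nhds hz1)).exists
  have hup : Tendsto (fun n => m ^ k * (cc q (n + k) / cc q n)⁻¹) atTop (𝓝 1) := by
    have hk0 : m ^ k ≠ 0 := (pow_pos hm0 k).ne'
    have := ((cc_ratio hq0 hq1 hm hm0 hm1 hmin hmin1 k).inv₀ hk0).const_mul (m ^ k)
    rwa [mul_inv_cancel₀ hk0] at this
  have hmid : Tendsto (fun n => (1 - gf νmin z) * ((1 - (gf q)^[n] z) / cc q n)⁻¹) atTop (𝓝 1) := by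
    refine tendsto_of_tendsto_of_tendsto_of_le_of_le tendsto_const_nhds hup (fun n => ?_)
      (fun n => ?_)
    · have i0 := iter_mem hq0 hq1 hm0 hmin hmin1 le_rfl zero_lt_one n
      have iz := iter_mem hq0 hq1 hm0 hmin hmin1 hz0 hz1 n
      have r := gf_ratio hmin.1 hmin1 i0.1
        (iter_mono hq0 hq1 hm0 hmin hmin1 le_rfl hz0 hz1 n) iz.2.le
      rw [iter_H hq0 hq1 hm0 hmin hmin1 le_rfl zero_lt_one n,
        iter_H hq0 hq1 hm0 hmin hmin1 hz0 hz1 n, hH0, sub_zero, mul_one, mul_assoc] at r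
      have r' := le_of_mul_le_mul_left r (pow_pos hm0 n)
      change _ ≤ _ * cc q n at r'
      have hp : 0 < 1 - (gf q)^[n] z := by linarith [iz.2]
      simp only
      rw [inv_div, mul_div_assoc', le_div_iff₀ hp, one_mul]
      exact r'
    · have i0 := iter_mem hq0 hq1 hm0 hmin hmin1 le_rfl zero_lt_one (n + k)
      have iz := iter_mem hq0 hq1 hm0 hmin hmin1 hz0 hz1 n
      have hle : (gf q)^[n] z ≤ (gf q)^[n + k] 0 := by
        rw [Function.iterate_add_apply]
        exact iter_mono hq0 hq1 hm0 hmin hmin1 hz0 hk.le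
          (iter_mem hq0 hq1 hm0 hmin hmin1 le_rfl zero_lt_one k).2 n
      have r := gf_ratio hmin.1 hmin1 iz.1 hle i0.2.le
      rw [iter_H hq0 hq1 hm0 hmin hmin1 le_rfl zero_lt_one (n + k),
        iter_H hq0 hq1 hm0 hmin hmin1 hz0 hz1 n, hH0, sub_zero, mul_one, pow_add, mul_assoc,
        mul_assoc] at r
      have r' := le_of_mul_le_mul_left r (pow_pos hm0 n)
      change _ * cc q (n + k) ≤ _ at r'
      have hp : 0 < 1 - (gf q)^[n] z := by linarith [iz.2]
      have hc := cc_pos hq0 hq1 hm0 hmin hmin1 (n + k)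
      have hc' := cc_pos hq0 hq1 hm0 hmin hmin1 n
      simp only
      rw [inv_div, inv_div, mul_div_assoc', mul_div_assoc', div_le_div_iff₀ hp hc]
      nlinarith
  have := (hmid.inv₀ one_ne_zero).const_mul (1 - gf νmin z)
  rw [inv_one, mul_one] at this
  refine this.congr fun n => ?_
  rw [mul_inv, inv_inv, mul_inv_cancel_left₀ hH.ne']

theorem log_ratio {x : ℕ → ℝ} (hx1 : ∀ n, x n < 1) (hx : Tendsto x atTop (𝓝 1)) :
    Tendsto (fun n => -Real.log (x n) / (1 - x n)) atTop (𝓝 1) := by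
  have h := (Real.hasDerivAt_log one_ne_zero).tendsto_slope
  have hx' : Tendsto x atTop (𝓝[≠] 1) :=
    tendsto_nhdsWithin_iff.2 ⟨hx, Eventually.of_forall fun n => (hx1 n).ne⟩
  have h2 := h.comp hx'
  rw [inv_one] at h2
  refine h2.congr fun n => ?_
  simp only [Function.comp, slope_def_field, Real.log_one, sub_zero]
  rw [← neg_sub, div_neg, neg_div]

/-- the limit of the Laplace arguments -/
theorem arg_tendsto (hq0 : ∀ k, 0 ≤ q k) (hq1 : HasSum q 1)
    (hm : HasSum (fun k : ℕ => (k : ℝ) * q k) m) (hm0 : 0 < m) (hm1 : m < 1)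
    (hmin : IsInvMeasure q m νmin) (hmin1 : HasSum νmin 1) {z : ℝ}
    (hz0 : 0 ≤ z) (hz1 : z < 1) (j : ℕ) {s : ℝ} (hs : m ^ j * s = 1 - gf νmin z) :
    Tendsto (fun n => -Real.log ((gf q)^[n] z) / cc q (n + j)) atTop (𝓝 s) := by
  have h1 := log_ratio (fun n => (iter_mem hq0 hq1 hm0 hmin hmin1 hz0 hz1 n).2)
    (iter_tendsto hq0 hq1 hm hm0 hm1 hmin hmin1 hz0 hz1)
  have h2 := yaglom hq0 hq1 hm hm0 hm1 hmin hmin1 hz0 hz1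
  have hk0 : m ^ j ≠ 0 := (pow_pos hm0 j).ne'
  have h3 := (cc_ratio hq0 hq1 hm hm0 hm1 hmin hmin1 j).inv₀ hk0
  have h4 := (h1.mul h2).mul h3
  rw [← hs, one_mul, mul_comm (m ^ j), mul_inv_cancel_right₀ hk0] at h4
  refine h4.congr fun n => ?_
  have hp : 1 - (gf q)^[n] z ≠ 0 := by
    have := (iter_mem hq0 hq1 hm0 hmin hmin1 hz0 hz1 n).2
    linarith
  have hc := (cc_pos hq0 hq1 hm0 hmin hmin1 (n + j)).ne'
  have hc' := (cc_pos hq0 hq1 hm0 hmin hmin1 n).ne'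
  field_simp

end dyn

section lap

/-- Laplace transform -/
noncomputable def Lap (μ : Measure ℝ) (s : ℝ) : ℝ≥0∞ := ∫⁻ x, ENNReal.ofReal (Real.exp (-s * x)) ∂μ

noncomputable def phi (x : ℝ) : unitInterval := Set.projIcc 0 1 zero_le_one (Real.exp (-x))

theorem phi_meas : Measurable phi := by
  have : Continuous phi := continuous_projIcc.comp (by fun_prop)
  exact this.measurable

theorem phi_coe {x : ℝ} (hx : 0 ≤ x) : ((phi x : unitInterval) : ℝ) = Real.exp (-x) := by
  unfold phi
  rw [Set.projIcc_of_mem zero_le_one (x := Real.exp (-x))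
    ⟨(Real.exp_pos _).le, Real.exp_le_one_iff.2 (by linarith)⟩]

noncomputable def TT (s : ℝ) (μ : Measure ℝ) : Measure unitInterval :=
  (μ.withDensity (fun x => ENNReal.ofReal (Real.exp (-s * x)))).map phi

noncomputable def SS (s : ℝ) (η : Measure unitInterval) : Measure ℝ :=
  ((η.restrict {y | (y : ℝ) ≠ 0}).map (fun y : unitInterval => -Real.log (y : ℝ))).withDensity
    (fun x => ENNReal.ofReal (Real.exp (s * x)))

theorem neglog_meas : Measurable (fun y : unitInterval => -Real.log (y : ℝ)) :=
  (Real.measurable_log.comp measurable_subtype_coe).neg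

theorem ne_meas : MeasurableSet {y : unitInterval | (y : ℝ) ≠ 0} :=
  (measurableSet_singleton (0:ℝ)).compl.preimage measurable_subtype_coe

theorem exp_meas (s : ℝ) : Measurable (fun x : ℝ => ENNReal.ofReal (Real.exp (s * x))) := by
  fun_prop

theorem TT_lint (s : ℝ) (μ : Measure ℝ) {f : unitInterval → ℝ≥0∞} (hf : Measurable f) :
    ∫⁻ y, f y ∂(TT s μ) = ∫⁻ x, ENNReal.ofReal (Real.exp (-s * x)) * f (phi x) ∂μ := by
  unfold TT
  rw [lintegral_map hf phi_meas, lintegral_withDensity_eq_lintegral_mul _ (exp_meas _)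
    (show Measurable fun x => f (phi x) from hf.comp phi_meas)]
  rfl

theorem SS_lint (s : ℝ) (η : Measure unitInterval) {f : ℝ → ℝ≥0∞} (hf : Measurable f) :
    ∫⁻ x, f x ∂(SS s η) = ∫⁻ y, indicator {y : unitInterval | (y : ℝ) ≠ 0}
      (fun y => ENNReal.ofReal (Real.exp (s * -Real.log (y : ℝ))) * f (-Real.log (y : ℝ))) y ∂η := by
  unfold SS
  rw [lintegral_withDensity_eq_lintegral_mul _ (exp_meas _) hf,
    lintegral_map ((exp_meas s).mul hf) neglog_meas, lintegral_indicator ne_meas]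
  rfl

theorem ae_nonneg_of {μ : Measure ℝ} (h : μ (Iio 0) = 0) : ∀ᵐ x ∂μ, 0 ≤ x := by
  rw [ae_iff]
  convert h using 2
  ext x; simp

theorem SS_TT (s : ℝ) {μ : Measure ℝ} (h : μ (Iio 0) = 0) : SS s (TT s μ) = μ := by
  refine Measure.ext_of_lintegral _ fun f hf => ?_
  rw [SS_lint s _ hf, TT_lint]
  · refine lintegral_congr_ae ?_
    filter_upwards [ae_nonneg_of h] with x hx
    have h1 : phi x ∈ {y : unitInterval | (y : ℝ) ≠ 0} := by
      show (phi x : ℝ) ≠ 0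
      rw [phi_coe hx]; exact (Real.exp_pos _).ne'
    rw [indicator_of_mem h1, phi_coe hx, Real.log_exp, neg_neg, ← mul_assoc,
      ← ENNReal.ofReal_mul (Real.exp_pos _).le, ← Real.exp_add]
    simp
  · exact (((exp_meas s).comp neglog_meas).mul (hf.comp neglog_meas)).indicator ne_meas

theorem SS_null (s : ℝ) (η : Measure unitInterval) : SS s η (Iio 0) = 0 := by
  unfold SS
  apply withDensity_absolutelyContinuous
  rw [Measure.map_apply neglog_meas measurableSet_Iio]
  have : (fun y : unitInterval => -Real.log (y : ℝ)) ⁻¹' (Iio 0) = ∅ := by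
    ext y
    have := Real.log_nonpos y.2.1 y.2.2
    simp only [mem_preimage, mem_Iio, mem_empty_iff_false, iff_false, not_lt]
    linarith
  rw [this, measure_empty]

theorem rpow_meas (d : ℝ) :
    Measurable (fun y : unitInterval => ENNReal.ofReal ((y : ℝ) ^ d)) := by
  fun_prop

theorem TT_moment (s d : ℝ) {μ : Measure ℝ} (h : μ (Iio 0) = 0) :
    ∫⁻ y : unitInterval, ENNReal.ofReal ((y : ℝ) ^ d) ∂(TT s μ) = Lap μ (s + d) := by
  rw [TT_lint _ _ (rpow_meas d)]
  refine lintegral_congr_ae ?_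
  filter_upwards [ae_nonneg_of h] with x hx
  rw [phi_coe hx, ← Real.exp_mul, ← ENNReal.ofReal_mul (Real.exp_pos _).le, ← Real.exp_add]
  congr 2; ring

theorem SS_moment (s : ℝ) {d : ℝ} (hd : 0 < d) (η : Measure unitInterval) :
    Lap (SS s η) (s + d) = ∫⁻ y : unitInterval, ENNReal.ofReal ((y : ℝ) ^ d) ∂η := by
  unfold Lap
  rw [SS_lint s η (exp_meas _)]
  congr 1
  funext y
  by_cases hy : (y : ℝ) = 0
  · rw [indicator_of_notMem (by simpa using hy), hy, Real.zero_rpow hd.ne', ENNReal.ofReal_zero]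
  · rw [indicator_of_mem (by simpa using hy), ← ENNReal.ofReal_mul (Real.exp_pos _).le,
      ← Real.exp_add, Real.rpow_def_of_pos (lt_of_le_of_ne y.2.1 (Ne.symm hy))]
    congr 2; ring

theorem TT_univ (s : ℝ) {μ : Measure ℝ} (h : μ (Iio 0) = 0) : TT s μ univ = Lap μ s := by
  have := TT_moment s 0 h
  simpa using this

theorem unit_ext {η₁ η₂ : Measure unitInterval} [IsFiniteMeasure η₁] [IsFiniteMeasure η₂]
    (h : ∀ k : ℕ, ∫ y : unitInterval, (y : ℝ) ^ k ∂η₁ = ∫ y : unitInterval, (y : ℝ) ^ k ∂η₂) :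
    η₁ = η₂ := by
  have hint : ∀ (η : Measure unitInterval) [IsFiniteMeasure η] (f : C(unitInterval, ℝ)),
      Integrable f η := fun η _ f =>
    (BoundedContinuousFunction.mkOfCompact f).integrable η
  have hcont : ∀ (η : Measure unitInterval) [IsFiniteMeasure η],
      Continuous (fun f : C(unitInterval, ℝ) => ∫ y, f y ∂η) := by
    intro η _
    have hL : LipschitzWith (η.real univ).toNNReal
        (fun f : C(unitInterval, ℝ) => ∫ y, f y ∂η) := by
      apply LipschitzWith.of_dist_le_mul
      intro f g
      rw [dist_eq_norm, dist_eq_norm, ← integral_sub (hint η f) (hint η g), mul_comm,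
        Real.coe_toNNReal _ measureReal_nonneg]
      exact norm_integral_le_of_norm_le_const
        (Eventually.of_forall fun y => (f - g).norm_coe_le_norm y)
    exact hL.continuous
  have hpoly : ∀ p : Polynomial ℝ, ∫ y : unitInterval, p.eval (y : ℝ) ∂η₁
      = ∫ y : unitInterval, p.eval (y : ℝ) ∂η₂ := by
    intro p
    simp_rw [Polynomial.eval_eq_sum_range]
    have hi : ∀ (η : Measure unitInterval) [IsFiniteMeasure η] (i : ℕ),
        Integrable (fun y : unitInterval => p.coeff i * (y : ℝ) ^ i) η := fun η _ i =>
      hint η ⟨fun y : unitInterval => p.coeff i * (y : ℝ) ^ i, by fun_prop⟩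
    rw [integral_finsetSum _ (fun i _ => hi η₁ i), integral_finsetSum _ (fun i _ => hi η₂ i)]
    refine Finset.sum_congr rfl fun i _ => ?_
    rw [integral_const_mul, integral_const_mul, h i]
  have hall : ∀ f : C(unitInterval, ℝ), ∫ y, f y ∂η₁ = ∫ y, f y ∂η₂ := by
    intro f
    have hcl : IsClosed {f : C(unitInterval, ℝ) | ∫ y, f y ∂η₁ = ∫ y, f y ∂η₂} :=
      isClosed_eq (hcont η₁) (hcont η₂)
    have hmem : f ∈ (polynomialFunctions unitInterval).topologicalClosure := by
      rw [polynomialFunctions_closure_eq_top']; trivial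
    refine closure_minimal ?_ hcl hmem
    rintro g ⟨p, -, rfl⟩
    exact hpoly p
  exact ext_of_forall_integral_eq_of_IsFiniteMeasure fun f => hall f.toContinuousMap

theorem Lap_ext {μ₁ μ₂ : Measure ℝ} (h1 : μ₁ (Iio 0) = 0) (h2 : μ₂ (Iio 0) = 0) (s : ℝ)
    (hfin : Lap μ₁ s ≠ ⊤) (h : ∀ k : ℕ, Lap μ₁ (s + k) = Lap μ₂ (s + k)) : μ₁ = μ₂ := by
  have h0 : Lap μ₁ s = Lap μ₂ s := by simpa using h 0
  have : IsFiniteMeasure (TT s μ₁) := ⟨by rw [TT_univ s h1]; exact hfin.lt_top⟩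
  have : IsFiniteMeasure (TT s μ₂) := ⟨by rw [TT_univ s h2, ← h0]; exact hfin.lt_top⟩
  rw [← SS_TT s h1, ← SS_TT s h2]
  congr 1
  refine unit_ext fun k => ?_
  have e : ∀ η : Measure unitInterval, ∫ y : unitInterval, (y : ℝ) ^ k ∂η =
      (∫⁻ y : unitInterval, ENNReal.ofReal ((y : ℝ) ^ (k : ℝ)) ∂η).toReal := by
    intro η
    rw [integral_eq_lintegral_of_nonneg_ae (Eventually.of_forall fun y => pow_nonneg y.2.1 k)
      (by fun_prop)]
    simp_rw [Real.rpow_natCast]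
  rw [e, e, TT_moment s k h1, TT_moment s k h2, h k]

end lap

section limit

/-- asymptotic Laplace values of a sequence of measures -/
def RR (μ : ℕ → Measure ℝ) (s : ℝ) (v : ℝ≥0∞) : Prop :=
  ∃ t : ℕ → ℝ, Tendsto t atTop (𝓝 s) ∧ ∀ᶠ n in atTop, Lap (μ n) (t n) = v

theorem int_rpow (η : Measure unitInterval) (d : ℝ) :
    ∫ y : unitInterval, (y : ℝ) ^ d ∂η =
      (∫⁻ y : unitInterval, ENNReal.ofReal ((y : ℝ) ^ d) ∂η).toReal := by
  rw [integral_eq_lintegral_of_nonneg_ae (Eventually.of_forall fun y => Real.rpow_nonneg y.2.1 d)]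
  exact (by fun_prop : Measurable fun y : unitInterval => (y : ℝ) ^ d).aestronglyMeasurable

theorem integrable_rpow (η : Measure unitInterval) [IsFiniteMeasure η] {d : ℝ} (hd : 0 ≤ d) :
    Integrable (fun y : unitInterval => (y : ℝ) ^ d) η := by
  refine Integrable.of_bound (C := 1)
    (by fun_prop : Measurable fun y : unitInterval => (y : ℝ) ^ d).aestronglyMeasurable
    (Eventually.of_forall fun y => ?_)
  rw [Real.norm_of_nonneg (Real.rpow_nonneg y.2.1 d)]
  exact Real.rpow_le_one y.2.1 y.2.2 hd

theorem rpow_le (η : Measure unitInterval) [IsFiniteMeasure η] {d e : ℝ} (hd : 0 < d)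
    (hde : d ≤ e) : ∫ y : unitInterval, (y : ℝ) ^ e ∂η ≤ ∫ y : unitInterval, (y : ℝ) ^ d ∂η := by
  refine integral_mono (integrable_rpow η (hd.le.trans hde)) (integrable_rpow η hd.le) fun y => ?_
  rcases eq_or_lt_of_le y.2.1 with hy | hy
  · simp only [← hy]
    rw [Real.zero_rpow hd.ne', Real.zero_rpow (by linarith)]
  · exact Real.rpow_le_rpow_of_exponent_ge hy y.2.2 hde

theorem moment_cont (η : Measure unitInterval) [IsFiniteMeasure η] {d : ℝ} (hd : 0 < d) :
    ContinuousAt (fun e : ℝ => ∫ y : unitInterval, (y : ℝ) ^ e ∂η) d := by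
  refine continuousAt_of_dominated (bound := fun _ => 1) (Eventually.of_forall fun e => ?_) ?_
    (integrable_const _) (Eventually.of_forall fun y => ?_)
  · exact (by fun_prop : Measurable fun y : unitInterval => (y : ℝ) ^ e).aestronglyMeasurable
  · filter_upwards [lt_mem_nhds hd] with e he
    refine Eventually.of_forall fun y => ?_
    rw [Real.norm_of_nonneg (Real.rpow_nonneg y.2.1 e)]
    exact Real.rpow_le_one y.2.1 y.2.2 he.le
  · exact Real.continuousAt_const_rpow' hd.ne'

theorem exists_limit (μ : ℕ → Measure ℝ) (hnull : ∀ n, μ n (Iio 0) = 0) {s0 : ℝ} {v0 : ℝ≥0∞}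
    (hv0 : v0 ≠ ⊤) (h0 : RR μ s0 v0) :
    ∃ μ' : Measure ℝ, μ' (Iio 0) = 0 ∧ ∀ s, s0 < s → ∀ v, v ≠ ⊤ → RR μ s v → Lap μ' s = v := by
  classical
  obtain ⟨t0, ht0, hL0⟩ := h0
  let ρ : ℕ → FiniteMeasure unitInterval := fun n =>
    if h : IsFiniteMeasure (TT (t0 n) (μ n)) then ⟨TT (t0 n) (μ n), h⟩ else 0
  have hρ : ∀ᶠ n in atTop, ((ρ n : FiniteMeasure unitInterval) : Measure unitInterval)
      = TT (t0 n) (μ n) := by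
    filter_upwards [hL0] with n hn
    have hf : IsFiniteMeasure (TT (t0 n) (μ n)) :=
      ⟨by rw [TT_univ _ (hnull n), hn]; exact hv0.lt_top⟩
    have e : ρ n = ⟨TT (t0 n) (μ n), hf⟩ := dif_pos hf
    rw [e]
    rfl
  have hmass : ∀ᶠ n in atTop, ρ n ∈ {η : FiniteMeasure unitInterval | η.mass ≤ v0.toNNReal} := by
    filter_upwards [hL0, hρ] with n hn hn'
    show (ρ n).mass ≤ _
    have : ((ρ n).mass : ℝ≥0∞) = v0 := by
      rw [FiniteMeasure.ennreal_mass, hn', TT_univ _ (hnull n), hn]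
    rw [← this, ENNReal.toNNReal_coe]
  have hU : (hyperfilter ℕ : Filter ℕ) ≤ atTop := Nat.hyperfilter_le_atTop
  obtain ⟨η, -, hη⟩ := (isCompact_setOfPred_finiteMeasure_le_of_compactSpace unitInterval
    v0.toNNReal).ultrafilter_le_nhds' ((hyperfilter ℕ).map ρ) (hU hmass)
  have hη' : Tendsto ρ (hyperfilter ℕ : Filter ℕ) (𝓝 η) := hη
  rw [FiniteMeasure.tendsto_iff_forall_integral_tendsto] at hη'
  refine ⟨SS s0 η, SS_null _ _, fun s hs v hv hR => ?_⟩
  obtain ⟨t, ht, hLt⟩ := hR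
  have hd : 0 < s - s0 := by linarith
  have hconv : ∀ d : ℝ, 0 < d → Tendsto (fun n => ∫ y : unitInterval, (y : ℝ) ^ d ∂(ρ n))
      (hyperfilter ℕ : Filter ℕ) (𝓝 (∫ y : unitInterval, (y : ℝ) ^ d ∂η)) := by
    intro d hd
    have hc : Continuous fun y : unitInterval => (y : ℝ) ^ d :=
      (Real.continuous_rpow_const hd.le).comp continuous_subtype_val
    exact hη' (BoundedContinuousFunction.mkOfCompact ⟨_, hc⟩)
  have hdn : Tendsto (fun n => t n - t0 n) atTop (𝓝 (s - s0)) := ht.sub ht0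
  have hval : ∀ᶠ n in atTop, ∫ y : unitInterval, (y : ℝ) ^ (t n - t0 n) ∂(ρ n) = v.toReal := by
    filter_upwards [hρ, hLt] with n h1 h2
    rw [h1, int_rpow, TT_moment _ _ (hnull n), add_sub_cancel, h2]
  have hup : ∀ d, s - s0 < d → ∫ y : unitInterval, (y : ℝ) ^ d ∂η ≤ v.toReal := by
    intro d hdd
    refine le_of_tendsto (hconv d (hd.trans hdd)) (hU ?_)
    filter_upwards [hval, hdn.eventually (gt_mem_nhds hdd), hdn.eventually (lt_mem_nhds hd)]
      with n h1 h2 h3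
    rw [← h1]
    exact rpow_le _ h3 h2.le
  have hlo : ∀ d, 0 < d → d < s - s0 → v.toReal ≤ ∫ y : unitInterval, (y : ℝ) ^ d ∂η := by
    intro d hd0 hdd
    refine ge_of_tendsto (hconv d hd0) (hU ?_)
    filter_upwards [hval, hdn.eventually (lt_mem_nhds hdd)] with n h1 h2
    rw [← h1]
    exact rpow_le _ hd0 h2.le
  have hM := moment_cont (η : Measure unitInterval) hd
  have e : ∫ y : unitInterval, (y : ℝ) ^ (s - s0) ∂η = v.toReal := by
    apply le_antisymm
    · refine le_of_tendsto (hM.tendsto.mono_left (nhdsWithin_le_nhds (s := Ioi (s - s0)))) ?_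
      filter_upwards [self_mem_nhdsWithin] with d hdd using hup d hdd
    · refine ge_of_tendsto (hM.tendsto.mono_left (nhdsWithin_le_nhds (s := Iio (s - s0)))) ?_
      filter_upwards [self_mem_nhdsWithin, mem_nhdsWithin_of_mem_nhds (lt_mem_nhds hd)]
        with d hdd hd0 using hlo d hd0 hdd
  have e2 : s = s0 + (s - s0) := by ring
  rw [e2, SS_moment s0 hd]
  rw [← ofReal_integral_eq_lintegral_ofReal (integrable_rpow _ hd.le)
    (Eventually.of_forall fun y => Real.rpow_nonneg y.2.1 _), e, ENNReal.ofReal_toReal hv]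

end limit

section fin

theorem Lap_map (μ : Measure ℝ) (m s : ℝ) : Lap (μ.map (fun x => m * x)) s = Lap μ (m * s) := by
  unfold Lap
  rw [lintegral_map (exp_meas _) (by fun_prop)]
  congr 1
  funext x
  congr 2; ring

theorem Lap_smul (μ : Measure ℝ) (c : ℝ≥0∞) (s : ℝ) : Lap (c • μ) s = c * Lap μ s := by
  unfold Lap
  rw [lintegral_smul_measure, smul_eq_mul]

/-- the rescaled measures -/
noncomputable def mun (q ν : ℕ → ℝ) (K : ℝ≥0∞) (n : ℕ) : Measure ℝ :=
  (K⁻¹) ^ n • Measure.sum (fun k : ℕ => ENNReal.ofReal (ν k) • Measure.dirac ((k : ℝ) * cc q n))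

theorem mun_lap (q : ℕ → ℝ) {ν : ℕ → ℝ} (hν : ∀ n, 0 ≤ ν n) (K : ℝ≥0∞) (n : ℕ) {x : ℝ}
    (hx : 0 < x) (hc : 0 < cc q n) :
    Lap (mun q ν K n) (-Real.log x / cc q n) = (K⁻¹) ^ n * egf ν x := by
  unfold mun
  rw [Lap_smul]
  congr 1
  unfold Lap egf
  rw [lintegral_sum_measure]
  congr 1
  funext k
  rw [lintegral_smul_measure, lintegral_dirac' _ (exp_meas _), smul_eq_mul,
    ← ENNReal.ofReal_mul (hν k)]
  congr 2
  have : -(-Real.log x / cc q n) * ((k : ℝ) * cc q n) = Real.log x * k := by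
    field_simp
  rw [this, Real.exp_mul, Real.exp_log hx, Real.rpow_natCast]

theorem mun_null (q ν : ℕ → ℝ) (K : ℝ≥0∞) (n : ℕ) (hc : 0 < cc q n) :
    mun q ν K n (Iio 0) = 0 := by
  unfold mun
  rw [Measure.smul_apply, Measure.sum_apply _ measurableSet_Iio, ENNReal.tsum_eq_zero.2, smul_zero]
  intro k
  rw [Measure.smul_apply, Measure.dirac_apply' _ measurableSet_Iio, indicator_of_notMem, smul_zero]
  simp only [mem_Iio, not_lt]
  positivity

theorem exists_true_measure (q : ℕ → ℝ) (hq0 : ∀ k, 0 ≤ q k) (hq1 : HasSum q 1)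
    (m : ℝ) (hm : HasSum (fun k : ℕ => (k : ℝ) * q k) m) (hm0 : 0 < m) (hm1 : m < 1)
    (νmin : ℕ → ℝ) (hmin : IsInvMeasure q m νmin) (hmin1 : HasSum νmin 1)
    (lam : ℝ) (hlam : 1 < lam)
    (ν : ℕ → ℝ) (hν : IsTrueInvMeasure q lam ν) :
    ∃ μ : Measure ℝ, μ (Iic 0) = 0 ∧ μ.map (fun x => m * x) = ENNReal.ofReal lam • μ ∧
      ∀ z ∈ Ioo (0:ℝ) 1, Lap μ (1 - gf νmin z) = egf ν z := by
  have hl0 : 0 ≤ lam := by linarith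
  set K := ENNReal.ofReal lam with hK
  have hK0 : K ≠ 0 := by
    rw [hK]; exact (ENNReal.ofReal_pos.2 (by linarith)).ne'
  have hKt : K ≠ ⊤ := ENNReal.ofReal_ne_top
  have hK1 : 1 < K := by
    rw [hK]; simpa using hlam
  have hKi : K⁻¹ ≠ ⊤ := ENNReal.inv_ne_top.2 hK0
  have hcp := fun n => cc_pos hq0 hq1 hm0 hmin hmin1 n
  have hG : ∀ z ∈ Ioo (0:ℝ) 1, egf ν z ≠ ⊤ := fun z hz =>
    egf_ne_top hq0 hq1 hm hm0 hm1 hmin hmin1 hl0 hν hz.1.le hz.2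
  have hGK : ∀ z ∈ Ioo (0:ℝ) 1, ∀ j : ℕ, (K⁻¹) ^ j * egf ν z ≠ ⊤ := fun z hz j =>
    ENNReal.mul_ne_top (ENNReal.pow_ne_top hKi) (hG z hz)
  have hRR : ∀ z ∈ Ioo (0:ℝ) 1, ∀ j : ℕ, ∀ s : ℝ, m ^ j * s = 1 - gf νmin z →
      RR (mun q ν K) s ((K⁻¹) ^ j * egf ν z) := by
    intro z hz j s hs
    refine ⟨fun n => -Real.log ((gf q)^[n - j] z) / cc q n, ?_, ?_⟩
    · rw [← tendsto_add_atTop_iff_nat j]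
      simp only [Nat.add_sub_cancel]
      exact arg_tendsto hq0 hq1 hm hm0 hm1 hmin hmin1 hz.1.le hz.2 j hs
    · filter_upwards [eventually_ge_atTop j] with n hn
      obtain ⟨i, rfl⟩ := Nat.exists_eq_add_of_le' hn
      rw [Nat.add_sub_cancel, mun_lap q hν.1 K (i + j)
        (iter_pos hq0 hq1 hm hm0 hm1 hmin hmin1 hz.1 hz.2 i) (hcp _),
        iter_egf hq0 hq1 hm0 hmin hmin1 hl0 hν hz.1.le hz.2 i, ← hK, add_comm i j, pow_add,
        mul_assoc, ← mul_assoc (K⁻¹ ^ i), ← mul_pow, ENNReal.inv_mul_cancel hK0 hKt, one_pow,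
        one_mul]
  have hsurj : ∀ s : ℝ, 0 < s → ∃ i : ℕ, ∃ z ∈ Ioo (0:ℝ) 1, m ^ (i + 1) * s = 1 - gf νmin z := by
    intro s hs
    have h1 : Tendsto (fun n : ℕ => m ^ n * s) atTop (𝓝 0) := by
      simpa using (tendsto_pow_atTop_nhds_zero_of_lt_one hm0.le hm1).mul_const s
    obtain ⟨n, hn1, hn2⟩ := ((h1.eventually (gt_mem_nhds zero_lt_one)).and
      (eventually_ge_atTop 1)).exists
    obtain ⟨i, rfl⟩ := Nat.exists_eq_add_of_le' hn2
    have hp : 0 < m ^ (i + 1) * s := by positivity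
    have hivt := intermediate_value_Ioo zero_le_one (gf_cont hmin.1 hmin1.summable)
    rw [gf_zero, hmin.2.1, gf_one hmin1] at hivt
    obtain ⟨z, hz, hz2⟩ := hivt (show 1 - m ^ (i + 1) * s ∈ Ioo (0:ℝ) 1 by
      constructor <;> linarith)
    exact ⟨i, z, hz, by rw [hz2]; ring⟩
  obtain ⟨i0, z0, hz0, hi0⟩ := hsurj 1 one_pos
  obtain ⟨μ, hμ0, hμ⟩ := exists_limit (mun q ν K) (fun n => mun_null q ν K n (hcp n))
    (hGK z0 hz0 _) (hRR z0 hz0 _ 1 hi0)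
  have hscale : ∀ s : ℝ, 1 < m * s → Lap μ (m * s) = K * Lap μ s ∧ Lap μ (m * s) ≠ ⊤ := by
    intro s hs
    have hs1 : 1 < s := by
      by_contra hcon
      push Not at hcon
      nlinarith
    obtain ⟨i, z, hz, hi⟩ := hsurj s (by linarith)
    rw [hμ s hs1 _ (hGK z hz _) (hRR z hz _ s hi),
      hμ (m * s) hs _ (hGK z hz i) (hRR z hz i (m * s) (by rw [← hi]; ring))]
    refine ⟨?_, hGK z hz i⟩
    rw [pow_succ', ← mul_assoc, ← mul_assoc, ENNReal.mul_inv_cancel hK0 hKt, one_mul]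
  have hmap : μ.map (fun x => m * x) = K • μ := by
    have hb : ∀ k : ℕ, 1 < m * (1 / m + 1 + k) := by
      intro k
      have : m * (1 / m + 1 + k) = 1 + m + m * k := by field_simp
      rw [this]
      have : 0 ≤ m * k := by positivity
      linarith
    refine Lap_ext ?_ ?_ (1 / m + 1) ?_ fun k => ?_
    · rw [Measure.map_apply (by fun_prop) measurableSet_Iio]
      convert hμ0 using 2
      ext x
      simp only [mem_preimage, mem_Iio]
      constructor
      · intro h; by_contra hx; push Not at hx; nlinarith [mul_nonneg hm0.le hx]
      · intro h; nlinarith [mul_pos hm0 (neg_pos.2 h)]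
    · rw [Measure.smul_apply, hμ0, smul_zero]
    · rw [Lap_map]
      have := (hscale (1 / m + 1) (by simpa using hb 0)).2
      exact this
    · rw [Lap_map, Lap_smul]
      exact (hscale _ (hb k)).1
  have hsc : ∀ s : ℝ, Lap μ (m * s) = K * Lap μ s := fun s => by
    rw [← Lap_map, hmap, Lap_smul]
  have hscn : ∀ (n : ℕ) (s : ℝ), Lap μ (m ^ n * s) = K ^ n * Lap μ s := by
    intro n s
    induction n with
    | zero => simp
    | succ n ih => rw [pow_succ', mul_assoc, hsc, ih, pow_succ', mul_assoc]
  have hfinal : ∀ z ∈ Ioo (0:ℝ) 1, Lap μ (1 - gf νmin z) = egf ν z := by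
    intro z hz
    have hs : 0 < 1 - gf νmin z := by linarith [gf_le_self hmin hmin1 hz.1.le hz.2.le, hz.2]
    obtain ⟨n, hn⟩ := exists_pow_lt_of_lt_one hs hm1
    have hmn : 0 < m ^ n := pow_pos hm0 n
    have e : m ^ n * ((1 - gf νmin z) / m ^ n) = 1 - gf νmin z := mul_div_cancel₀ _ hmn.ne'
    rw [← e, hscn, hμ _ ((one_lt_div hmn).2 hn) _ (hGK z hz n) (hRR z hz n _ e), ← mul_assoc,
      ← mul_pow, ENNReal.mul_inv_cancel hK0 hKt, one_pow, one_mul]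
  refine ⟨μ, ?_, hmap, hfinal⟩
  have hsing : μ {0} = 0 := by
    have h1 : μ {0} = K * μ {0} := by
      have h2 := congrArg (fun κ : Measure ℝ => κ {0}) hmap
      simp only [Measure.smul_apply, smul_eq_mul] at h2
      rw [Measure.map_apply (by fun_prop) (measurableSet_singleton 0)] at h2
      rw [← h2]
      congr 1
      ext x
      simp [hm0.ne']
    have hfin : μ {0} ≠ ⊤ := by
      have h3 := setLIntegral_le_lintegral (μ := μ) {(0:ℝ)}
        (fun x => ENNReal.ofReal (Real.exp (-(1 - gf νmin z0) * x)))
      rw [lintegral_singleton] at h3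
      simp only [mul_zero, Real.exp_zero, ENNReal.ofReal_one, one_mul] at h3
      refine ne_top_of_le_ne_top ?_ h3
      have := hfinal z0 hz0
      unfold Lap at this
      rw [this]
      exact hG z0 hz0
    by_contra hne
    have := ENNReal.mul_lt_mul_left hne hfin hK1
    rw [one_mul] at this
    exact absurd h1 this.ne
  have : Iic (0:ℝ) = Iio 0 ∪ {0} := by ext x; simp [le_iff_lt_or_eq]
  rw [this]
  exact measure_union_null hμ0 hsing

end fin

theorem true_invariant_measure_integral_representation
    (q : ℕ → ℝ) (hq0 : ∀ k, 0 ≤ q k) (hq1 : HasSum q 1)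
    (m : ℝ) (hm : HasSum (fun k : ℕ => (k : ℝ) * q k) m) (hm0 : 0 < m) (hm1 : m < 1)
    (νmin : ℕ → ℝ) (hmin : IsInvMeasure q m νmin) (hmin1 : HasSum νmin 1)
    (α : ℝ) (hα : α < 0)
    (ν : ℕ → ℝ) (hν : IsTrueInvMeasure q (m ^ α) ν) :
    (∀ z ∈ Set.Ico (0 : ℝ) 1, Summable fun n => ν n * z ^ n) ∧
    ∃ Λ : Measure ℝ, IsLocFiniteOnPos Λ ∧ ScaleInvariant m Λ ∧
      ∀ z ∈ Set.Ioo (0 : ℝ) 1,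
        ∑' n, ν n * z ^ n =
          ∫ x in Set.Ioi (0 : ℝ),
            Real.exp (((∑' n, νmin n * z ^ n) - 1) * x) * x ^ (-α) ∂Λ := by
  have hlam : 1 < m ^ α := Real.one_lt_rpow_of_pos_of_lt_one_of_neg hm0 hm1 hα
  have hG : ∀ z ∈ Set.Ico (0 : ℝ) 1, egf ν z ≠ ⊤ := fun z hz =>
    egf_ne_top hq0 hq1 hm hm0 hm1 hmin hmin1 (by linarith) hν hz.1 hz.2
  have hsum : ∀ z ∈ Set.Ico (0 : ℝ) 1, Summable fun n => ν n * z ^ n := by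
    intro z hz
    refine (ENNReal.summable_toReal (hG z hz)).congr fun n => ?_
    exact ENNReal.toReal_ofReal (mul_nonneg (hν.1 n) (pow_nonneg hz.1 n))
  refine ⟨hsum, ?_⟩
  obtain ⟨μ, hμ0, hmap, hμ⟩ := exists_true_measure q hq0 hq1 m hm hm0 hm1 νmin hmin hmin1
    (m ^ α) hlam ν hν
  have hfm : Measurable fun x : ℝ => ENNReal.ofReal (x ^ α) := by fun_prop
  refine ⟨μ.withDensity (fun x => ENNReal.ofReal (x ^ α)), ⟨?_, ?_⟩, ?_, ?_⟩
  · exact withDensity_absolutelyContinuous _ _ hμ0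
  · intro C hC hC0
    rw [withDensity_apply _ hC.isClosed.measurableSet]
    set s : ℝ := 1 - gf νmin (1 / 2) with hs
    have hfin : Lap μ s ≠ ⊤ := by
      rw [hs, hμ (1 / 2) (by constructor <;> norm_num)]
      exact hG (1 / 2) (by constructor <;> norm_num)
    have hcont : ContinuousOn (fun x : ℝ => x ^ α * Real.exp (s * x)) C := by
      refine ContinuousOn.mul (fun x hx => ?_) (by fun_prop)
      exact (Real.continuousAt_rpow_const x α (Or.inl (hC0 hx).ne')).continuousWithinAt
    obtain ⟨B, hB⟩ := hC.exists_bound_of_continuousOn hcont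
    have hle : ∫⁻ x in C, ENNReal.ofReal (x ^ α) ∂μ ≤ ENNReal.ofReal B * Lap μ s := by
      calc _ ≤ ∫⁻ x in C, ENNReal.ofReal B * ENNReal.ofReal (Real.exp (-s * x)) ∂μ := by
            refine setLIntegral_mono' hC.isClosed.measurableSet fun x hx => ?_
            have hb := hB x hx
            have hxp : 0 < x := hC0 hx
            have hBn : 0 ≤ B := (norm_nonneg _).trans hb
            rw [← ENNReal.ofReal_mul hBn]
            apply ENNReal.ofReal_le_ofReal
            rw [Real.norm_of_nonneg (by positivity)] at hb
            calc x ^ α = (x ^ α * Real.exp (s * x)) * Real.exp (-s * x) := by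
                  rw [mul_assoc, ← Real.exp_add]; simp
              _ ≤ _ := mul_le_mul_of_nonneg_right hb (Real.exp_pos _).le
        _ ≤ ∫⁻ x, ENNReal.ofReal B * ENNReal.ofReal (Real.exp (-s * x)) ∂μ :=
            setLIntegral_le_lintegral _ _
        _ = _ := lintegral_const_mul _ (exp_meas _)
    exact hle.trans_lt (ENNReal.mul_ne_top ENNReal.ofReal_ne_top hfin).lt_top
  · intro A hA hA0
    have hemb : MeasurableEmbedding (fun x : ℝ => m * x) := measurableEmbedding_mulLeft₀ hm0.ne'
    have hmA := hemb.measurableSet_image.2 hA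
    rw [withDensity_apply _ hA, withDensity_apply _ hmA]
    have hK0 : ENNReal.ofReal (m ^ α) ≠ 0 := (ENNReal.ofReal_pos.2 (by linarith)).ne'
    have key : ENNReal.ofReal (m ^ α) * ∫⁻ x in (fun x => m * x) '' A, ENNReal.ofReal (x ^ α) ∂μ
        = ENNReal.ofReal (m ^ α) * ∫⁻ x in A, ENNReal.ofReal (x ^ α) ∂μ := by
      rw [← smul_eq_mul, ← lintegral_smul_measure, ← Measure.restrict_smul, ← hmap,
        hemb.restrict_map, hemb.lintegral_map, hemb.injective.preimage_image,
        ← lintegral_const_mul _ hfm]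
      refine setLIntegral_congr_fun hA fun x hx => ?_
      rw [Real.mul_rpow hm0.le (le_of_lt (hA0 hx)), ENNReal.ofReal_mul (by linarith)]
    exact ((ENNReal.mul_right_inj hK0 ENNReal.ofReal_ne_top).1 key).symm
  · intro z hz
    have hz' : z ∈ Set.Ico (0:ℝ) 1 := ⟨hz.1.le, hz.2⟩
    have e1 : ∑' n, ν n * z ^ n = (egf ν z).toReal := by
      unfold egf
      rw [← ENNReal.ofReal_tsum_of_nonneg (fun n => mul_nonneg (hν.1 n) (pow_nonneg hz.1.le n))
        (hsum z hz'), ENNReal.toReal_ofReal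
        (tsum_nonneg fun n => mul_nonneg (hν.1 n) (pow_nonneg hz.1.le n))]
    rw [e1, ← hμ z hz]
    change _ = ∫ x in Set.Ioi (0:ℝ), Real.exp ((gf νmin z - 1) * x) * x ^ (-α) ∂_
    have hmeas : Measurable fun x : ℝ => Real.exp ((gf νmin z - 1) * x) * x ^ (-α) := by fun_prop
    rw [integral_eq_lintegral_of_nonneg_ae]
    · congr 1
      rw [setLIntegral_withDensity_eq_setLIntegral_mul μ hfm hmeas.ennreal_ofReal
        measurableSet_Ioi]
      have e2 : Lap μ (1 - gf νmin z) =
          ∫⁻ x in Set.Ioi 0, ENNReal.ofReal (Real.exp (-(1 - gf νmin z) * x)) ∂μ := by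
        unfold Lap
        rw [← lintegral_add_compl _ (measurableSet_Ioi (a := (0:ℝ))), Set.compl_Ioi,
          setLIntegral_measure_zero _ _ hμ0, add_zero]
      rw [e2]
      refine setLIntegral_congr_fun measurableSet_Ioi fun x hx => ?_
      have hxp : (0:ℝ) < x := hx
      simp only [Pi.mul_apply]
      rw [← ENNReal.ofReal_mul (Real.rpow_nonneg hxp.le _)]
      congr 1
      rw [mul_left_comm, ← Real.rpow_add hxp, add_neg_cancel, Real.rpow_zero, mul_one]
      congr 1; ring
    · filter_upwards [ae_restrict_mem measurableSet_Ioi] with x hx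
      have hxp : (0:ℝ) < x := hx
      show 0 ≤ Real.exp ((gf νmin z - 1) * x) * x ^ (-α)
      positivity
    · exact hmeas.aestronglyMeasurable
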